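/- Fix n ≥ 1 and let w : {1,…,n} → {a, b, a⁻¹, b⁻¹} be the word whose i-th letter is a, b, a⁻¹ or b⁻¹ according as i ≡ 1, 2, 3 or 0 (mod 4), i.e. w is a prefix of the periodic word a b a⁻¹ b⁻¹ a b a⁻¹ b⁻¹ ⋯. Suppose π is a non-crossing partition of {1,…,n} each of whose blocks is either a singleton or a pair {i, j} whose two letters are mutually inverse, i.e. {w(i), w(j)} equals {a, a⁻¹} or {b, b⁻¹}. Then π has at least n/4 singleton blocks. -/

import Mathlib

namespace NCWord

/-- The four formal letters `a, b, a⁻¹, b⁻¹`. -/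
inductive Letter
  | a | b | ai | bi
deriving DecidableEq

/-- The formal inverse of a letter. -/
def Letter.inv : Letter → Letter
  | .a => .ai
  | .ai => .a
  | .b => .bi
  | .bi => .b

/-- The word `a b a⁻¹ b⁻¹ a b a⁻¹ b⁻¹ ⋯`: the `i`-th letter (with `i` zero-based, so
position `i+1` among `{1,…,n}`) is `a`, `b`, `a⁻¹`, `b⁻¹` according as the position is
`≡ 1, 2, 3, 0 (mod 4)`. -/
def word (n : ℕ) (i : Fin n) : Letter :=
  match i.val % 4 with
  | 0 => .a
  | 1 => .b
  | 2 => .ai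
  | _ => .bi

/-- `x` and `y` lie in the same block of the partition `π`. -/
def SameBlock {n : ℕ} (π : Finpartition (Finset.univ : Finset (Fin n))) (x y : Fin n) :
    Prop :=
  ∃ B ∈ π.parts, x ∈ B ∧ y ∈ B

/-- A partition of `{1,…,n}` is non-crossing if there are no indices `i < j < k < l` with
`i, k` in one block and `j, l` in a different block. -/
def IsNonCrossing {n : ℕ} (π : Finpartition (Finset.univ : Finset (Fin n))) : Prop :=
  ¬ ∃ i j k l : Fin n, i < j ∧ j < k ∧ k < l ∧
      SameBlock π i k ∧ SameBlock π j l ∧ ¬ SameBlock π i j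

open Finset in
/-- For a non-crossing involution whose `2`-cycles join positions differing by `2` modulo `4`,
an invariant interval with `s` outermost fixed points and `p` outermost `2`-cycles has length
congruent to `s + 3 * p` modulo `4`, and at most four times its number of fixed points, less
`3 * s + p`. -/
theorem exists_outer_counts (f : ℕ → ℕ) (hinv : ∀ i, f (f i) = i)
    (hmod : ∀ i, f i = i ∨ f i % 4 = (i + 2) % 4)
    (hnc : ∀ i j, i < j → j < f i → f i < f j → False) (d : ℕ) :
    ∀ l r, l + d = r → (∀ i, l ≤ i → i < r → l ≤ f i ∧ f i < r) →
      ∃ s p : ℕ, d % 4 = (s + 3 * p) % 4 ∧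
        d + 3 * s + p ≤ 4 * ∑ i ∈ Ico l r, if f i = i then 1 else 0 := by
  induction d using Nat.strong_induction_on with
  | _ d ih =>
    intro l r hd hcl
    rcases Nat.eq_zero_or_pos d with rfl | hpos
    · exact ⟨0, 0, by simp⟩
    have hlr : l < r := by omega
    obtain ⟨hl, hr⟩ := hcl l le_rfl hlr
    rw [sum_eq_sum_Ico_succ_bot hlr]
    by_cases hfix : f l = l
    · have hcl' : ∀ i, l + 1 ≤ i → i < r → l + 1 ≤ f i ∧ f i < r := by
        intro i h₁ h₂
        have h := hcl i (by omega) h₂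
        have hne : f i ≠ l := by
          intro e
          have := hinv i
          rw [e, hfix] at this
          omega
        omega
      obtain ⟨s, p, h₁, h₂⟩ := ih (d - 1) (by omega) (l + 1) r (by omega) hcl'
      refine ⟨s + 1, p, by omega, ?_⟩
      rw [if_pos hfix]
      omega
    · obtain ⟨m, hm⟩ : ∃ m, f l = m := ⟨_, rfl⟩
      have hml : f m = l := by rw [← hm, hinv]
      have hmod' := (hmod l).resolve_left hfix
      rw [hm] at hl hr hfix hmod'
      have hne_l : ∀ i, i ≠ m → f i ≠ l := by
        intro i hi e
        have := hinv i
        rw [e, hm] at this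
        omega
      have hne_m : ∀ i, i ≠ l → f i ≠ m := by
        intro i hi e
        have := hinv i
        rw [e, hml] at this
        omega
      have hin : ∀ i, l + 1 ≤ i → i < m → l + 1 ≤ f i ∧ f i < m := by
        intro i h₁ h₂
        have h := hcl i (by omega) (by omega)
        have h₃ := hne_l i (by omega)
        have h₄ := hne_m i (by omega)
        have h₅ : ¬ f l < f i := hnc l i (by omega) (by omega)
        omega
      have hout : ∀ i, m + 1 ≤ i → i < r → m + 1 ≤ f i ∧ f i < r := by
        intro i h₁ h₂
        have h := hcl i (by omega) h₂
        have h₃ := hne_l i (by omega)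
        have h₄ := hne_m i (by omega)
        by_contra h₅
        have h₆ := hin (f i) (by omega) (by omega)
        rw [hinv] at h₆
        omega
      obtain ⟨s, p, h₁, h₂⟩ := ih (m - (l + 1)) (by omega) (l + 1) m (by omega) hin
      obtain ⟨t, q, h₃, h₄⟩ := ih (r - (m + 1)) (by omega) (m + 1) r (by omega) hout
      refine ⟨t, q + 1, by omega, ?_⟩
      rw [← sum_Ico_consecutive _ (show l + 1 ≤ m by omega) hr.le,
        sum_eq_sum_Ico_succ_bot hr]
      omega

theorem word_eq_inv_mod {n : ℕ} {i j : Fin n} (h : word n j = (word n i).inv) :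
    j.val % 4 = (i.val + 2) % 4 := by
  have hi : i.val % 4 < 4 := Nat.mod_lt _ (by norm_num)
  have hj : j.val % 4 < 4 := Nat.mod_lt _ (by norm_num)
  unfold word at h
  rw [Nat.add_mod]
  generalize i.val % 4 = x at *
  generalize j.val % 4 = y at *
  interval_cases x <;> interval_cases y <;> simp_all [Letter.inv]

open Finset in
/-- The partner function of a partition into singletons and pairs of inverse letters. -/
theorem exists_partner {n : ℕ} (π : Finpartition (univ : Finset (Fin n)))
    (hblocks : ∀ B ∈ π.parts, B.card = 1 ∨
      ∃ i j : Fin n, i ≠ j ∧ B = {i, j} ∧ word n j = (word n i).inv) (x : Fin n) :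
    ∃ y, π.part x = {x, y} ∧ (y = x ∨ y.val % 4 = (x.val + 2) % 4) := by
  have hx : x ∈ π.part x := π.mem_part (mem_univ x)
  rcases hblocks _ (π.part_mem.2 (mem_univ x)) with h | ⟨i, j, -, hB, hw⟩
  · obtain ⟨z, hz⟩ := card_eq_one.1 h
    rw [hz, mem_singleton] at hx
    subst hx
    exact ⟨x, by simpa using hz, Or.inl rfl⟩
  · have hmod := word_eq_inv_mod hw
    rw [hB, mem_insert, mem_singleton] at hx
    rcases hx with rfl | rfl
    · exact ⟨j, hB, Or.inr hmod⟩
    · exact ⟨i, by rw [hB, pair_comm], Or.inr (by omega)⟩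

/-- If `π` is a non-crossing partition of `{1,…,n}` each of whose blocks
is a singleton or a pair of positions carrying mutually inverse letters of the periodic
word `a b a⁻¹ b⁻¹ ⋯`, then `π` has at least `n/4` singleton blocks. -/
theorem noncrossing_pairing_many_singletons (n : ℕ) (hn : 1 ≤ n)
    (π : Finpartition (Finset.univ : Finset (Fin n)))
    (hnc : IsNonCrossing π)
    (hblocks : ∀ B ∈ π.parts, B.card = 1 ∨
      ∃ i j : Fin n, i ≠ j ∧ B = {i, j} ∧ word n j = (word n i).inv) :
    (n : ℝ) / 4 ≤ ((π.parts.filter fun B => B.card = 1).card : ℝ) := by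
  choose f hpart hmod using exists_partner π hblocks
  have hmem : ∀ x, f x ∈ π.part x := fun x => by simp [hpart x]
  have hpart_eq : ∀ x, π.part (f x) = π.part x := fun x =>
    π.part_eq_of_mem (π.part_mem.2 (Finset.mem_univ x)) (hmem x)
  have hinv : ∀ x, f (f x) = x := by
    intro x
    by_cases hx : f x = x
    · rw [hx, hx]
    have h : x ∈ π.part (f x) := by simp [hpart_eq x, hpart x]
    rw [hpart (f x), Finset.mem_insert, Finset.mem_singleton] at h
    exact (h.resolve_left (Ne.symm hx)).symm
  have hsame : ∀ x, SameBlock π x (f x) := fun x =>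
    ⟨π.part x, π.part_mem.2 (Finset.mem_univ x), π.mem_part (Finset.mem_univ x), hmem x⟩
  have hcross : ∀ i j, i < j → j < f i → f i < f j → False := by
    intro i j h₁ h₂ h₃
    refine hnc ⟨i, j, f i, f j, h₁, h₂, h₃, hsame i, hsame j, ?_⟩
    rintro ⟨B, hB, hi, hj⟩
    rw [← π.part_eq_of_mem hB hi, hpart i, Finset.mem_insert, Finset.mem_singleton] at hj
    rcases hj with rfl | rfl
    · exact h₁.false
    · exact h₂.false
  let g : ℕ → ℕ := fun i => if h : i < n then f ⟨i, h⟩ else i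
  have g_lt : ∀ {i} (h : i < n), g i = f ⟨i, h⟩ := fun h => dif_pos h
  have g_ge : ∀ {i}, ¬ i < n → g i = i := fun h => dif_neg h
  have g_val : ∀ x : Fin n, g x = f x := fun x => g_lt x.isLt
  obtain ⟨s, p, -, hle⟩ := exists_outer_counts g
    (fun i => by
      by_cases h : i < n
      · rw [g_lt h, g_val, hinv]
      · rw [g_ge h, g_ge h])
    (fun i => by
      by_cases h : i < n
      · rw [g_lt h]
        exact (hmod ⟨i, h⟩).imp_left (congrArg Fin.val)
      · exact Or.inl (g_ge h))
    (fun i j h₁ h₂ h₃ => by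
      by_cases hi : i < n
      · rw [g_lt hi] at h₂ h₃
        have hj : j < n := h₂.trans (Fin.isLt _)
        rw [g_lt hj] at h₃
        exact hcross ⟨i, hi⟩ ⟨j, hj⟩ h₁ h₂ h₃
      · rw [g_ge hi] at h₂
        omega)
    n 0 n (zero_add n)
    (fun i _ h => ⟨Nat.zero_le _, by rw [g_lt h]; exact Fin.isLt _⟩)
  have hcard : (∑ i ∈ Finset.Ico 0 n, if g i = i then 1 else 0) ≤
      (π.parts.filter fun B => B.card = 1).card := by
    rw [← Finset.range_eq_Ico, ← Fin.sum_univ_eq_sum_range (fun i => if g i = i then 1 else 0),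
      ← Finset.card_filter]
    have hsingle : ∀ x : Fin n, g x = x → π.part x = {x} := by
      intro x hx
      rw [hpart x, Fin.ext ((g_val x).symm.trans hx), Finset.pair_eq_singleton]
    refine Finset.card_le_card_of_injOn (fun x => π.part x) ?_ ?_
    · intro x hx
      have hx' := hsingle x (Finset.mem_filter.1 hx).2
      refine Finset.mem_coe.2 (Finset.mem_filter.2
        ⟨π.part_mem.2 (Finset.mem_univ x), ?_⟩)
      simp only [hx', Finset.card_singleton]
    · intro x hx y hy hxy
      simp only [hsingle x (Finset.mem_filter.1 hx).2, hsingle y (Finset.mem_filter.1 hy).2] at hxy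
      exact Finset.singleton_injective hxy
  have hfour : (n : ℝ) ≤ 4 * ((π.parts.filter fun B => B.card = 1).card : ℝ) := by
    exact_mod_cast (show n ≤ 4 * (π.parts.filter fun B => B.card = 1).card by omega)
  linarith

end NCWord
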